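/- Let H ∈ ℂ(Y) be a non-constant rational function and let F = ℂ(x, L) be the differential field with x' = 1 and L' = 1/x (L transcendental over ℂ(x), playing the role of log x), with constants ℂ. If H(L) has no antiderivative in F, then H(L) has no antiderivative in any transcendental dilogarithmic-elementary extension of F with constants ℂ. In particular, the logarithmic integral ∫ dx/log x does not belong to any transcendental dilogarithmic-elementary extension of ℂ(x, log x). -/

import Mathlib

universe u v

/-- `θ` is a transcendental dilogarithmic-elementary generator over the base
subfield `B`. -/
def IsTransDilogElemGen {E : Type v} [Field E] [CharZero E]
    (δ : Derivation ℚ E E) (B : Subfield E) (θ : E) : Prop :=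
  Transcendental (↥B) θ ∧
    ((∃ a ∈ B, δ θ = δ a * θ) ∨
     (∃ a ∈ B, a ≠ 0 ∧ δ θ = δ a / a) ∨
     (∃ g ∈ B, g ≠ 0 ∧ g ≠ 1 ∧ ∃ η ∈ B,
        δ η = -(δ (1 - g) / (1 - g)) ∧ δ θ = (δ g / g) * η))

/-- `E = F(θ₁,…,θₙ)` is a transcendental dilogarithmic-elementary tower over
the subfield `F`. -/
def IsTransDilogElemTower {E : Type v} [Field E] [CharZero E]
    (δ : Derivation ℚ E E) (F : Subfield E) {n : ℕ} (θ : Fin n → E) : Prop :=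
  (∀ i : Fin n,
      IsTransDilogElemGen δ
        (Subfield.closure ((F : Set E) ∪ θ '' {j : Fin n | j < i})) (θ i)) ∧
    Subfield.closure ((F : Set E) ∪ Set.range θ) = ⊤

open scoped TensorProduct in
theorem der_extend {K A E : Type*} [CommRing K] [CommRing A] [CommRing E] [Algebra K A]
    [Algebra K E] [Algebra A E] [IsScalarTower K A E] [Algebra.FormallyEtale A E]
    (d0 : Derivation K A E) : ∃ Y : Derivation K E E, ∀ a, Y (algebraMap A E a) = d0 a := by
  let l : Ω[A⁄K] →ₗ[A] E := d0.liftKaehlerDifferential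
  let l2 : E ⊗[A] Ω[A⁄K] →ₗ[E] E := LinearMap.liftBaseChange E l
  let l3 : Ω[E⁄K] →ₗ[E] E := l2.comp
    (KaehlerDifferential.tensorKaehlerEquivOfFormallyEtale K A E).symm.toLinearMap
  refine ⟨l3.compDer (KaehlerDifferential.D K E), fun a => ?_⟩
  have h : (l3.compDer (KaehlerDifferential.D K E)) (algebraMap A E a) = 
    l2 ((KaehlerDifferential.tensorKaehlerEquivOfFormallyEtale K A E).symm
      (KaehlerDifferential.D K E (algebraMap A E a))) := rfl
  rw [h, KaehlerDifferential.tensorKaehlerEquivOfFormallyEtale_symm_D_algebraMap]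
  simp [l2, l]

open scoped IntermediateField.algebraAdjoinAdjoin in
theorem exists_der_ne_zero {K E : Type*} [Field K] [Field E] [Algebra K E] [CharZero E]
    (u : E) (hu : Transcendental K u) : ∃ Y : Derivation K E E, Y u ≠ 0 := by
  classical
  have hs : AlgebraicIndepOn K id ({u} : Set E) := by
    have := (algebraicIndependent_unique_type_iff (R := K)
      (x := fun i : ({u} : Set E) => (i : E))).2 (by simpa using hu)
    exact this
  obtain ⟨t, hut, ht⟩ := exists_isTranscendenceBasis_superset hs
  have hb := ht.1
  let v : t → E := Subtype.val
  let A := Algebra.adjoin K (Set.range v)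
  let L := IntermediateField.adjoin K (Set.range v)
  have : CharZero L := (algebraMap L E).charZero
  have : Algebra.IsAlgebraic L E := by
    exact ht.isAlgebraic_field
  have : Algebra.FormallyEtale L E := Algebra.FormallyEtale.of_isSeparable _ _
  have : Algebra.FormallyEtale A L := .of_isLocalization (nonZeroDivisors A)
  have : IsScalarTower A L E := inferInstance
  have : Algebra.FormallyEtale A E := .comp A L E
  let e : MvPolynomial t K ≃ₐ[K] A := hb.aevalEquiv
  let i : t := ⟨u, hut rfl⟩
  let d0 : Derivation K A E := Derivation.mk'
    { toFun := fun a => ((e (MvPolynomial.pderiv i (e.symm a)) : A) : E)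
      map_add' := by intro a b; simp
      map_smul' := by
        intro a b
        rw [map_smul, Derivation.map_smul, map_smul]
        rfl }
    (by
      intro a b
      simp [Algebra.smul_def, Derivation.leibniz])
  obtain ⟨Y, hY⟩ := der_extend (E := E) d0
  refine ⟨Y, ?_⟩
  have hX : (algebraMap A E (e (MvPolynomial.X i))) = u := by
    have := hb.algebraMap_aevalEquiv (MvPolynomial.X i)
    rw [MvPolynomial.aeval_X] at this
    exact this
  have : Y u = 1 := by
    conv_lhs => rw [← hX]
    rw [hY]
    simp [d0]
  rw [this]; exact one_ne_zero

open Polynomial in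
theorem alg_descend {R F E : Type*} [CommRing R] [Field F] [Field E] [Algebra F E] [CharZero F]
    [Algebra R E] (dF : F → F) (dE : Derivation R E E)
    (hcomp : ∀ y, dE (algebraMap F E y) = algebraMap F E (dF y)) (α γ : F) (h : E)
    (hh : dE h = algebraMap F E α * h + algebraMap F E γ) (halg : IsAlgebraic F h) :
    ∃ g : F, dF g = α * g + γ := by
  have hinj := (algebraMap F E).injective
  have hadd : ∀ a b, dF (a + b) = dF a + dF b := fun a b => hinj (by
    rw [← hcomp, map_add, map_add, map_add, hcomp, hcomp])
  have hzero : dF 0 = 0 := hinj (by rw [← hcomp, map_zero, map_zero])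
  have hmul : ∀ a b, dF (a * b) = a * dF b + b * dF a := fun a b => hinj (by
    rw [← hcomp, map_mul, Derivation.leibniz, hcomp, hcomp]; simp)
  have hone : dF 1 = 0 := hinj (by rw [← hcomp, map_one, map_zero]; simp)
  have hnat : ∀ n : ℕ, dF n = 0 := fun n => hinj (by rw [← hcomp, map_natCast]; simp)
  have hint := halg.isIntegral
  set p := minpoly F h with hp
  have hmon : p.Monic := minpoly.monic hint
  obtain ⟨n, hn⟩ : ∃ n, p.natDegree = n + 1 :=
    Nat.exists_eq_succ_of_ne_zero (minpoly.natDegree_pos hint).ne'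
  have key : ∀ q : F[X], ∃ r : F[X], (∀ i, r.coeff i = dF (q.coeff i)) ∧
      dE (aeval h q) = aeval h r + aeval h (derivative q) * dE h := by
    intro q
    induction q using Polynomial.induction_on' with
    | add a b ha hb =>
      obtain ⟨r, hr1, hr2⟩ := ha
      obtain ⟨s, hs1, hs2⟩ := hb
      refine ⟨r + s, fun i => by simp [hr1, hs1, hadd], ?_⟩
      simp only [map_add, hr2, hs2]; ring
    | monomial m a =>
      refine ⟨monomial m (dF a), fun i => ?_, ?_⟩
      · simp only [coeff_monomial]; split_ifs <;> simp [hzero]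
      · simp only [aeval_monomial, Derivation.leibniz, Derivation.leibniz_pow, hcomp,
          derivative_monomial, map_mul, map_natCast, smul_eq_mul, nsmul_eq_mul]
        ring
  obtain ⟨r, hr1, hr2⟩ := key p
  set q := r + derivative p * (C α * X + C γ) - C ((n + 1 : ℕ) * α) * p with hq
  have hq0 : aeval h q = 0 := by
    have h0 : aeval h p = 0 := minpoly.aeval F h
    rw [h0, map_zero, hh] at hr2
    simp only [hq, map_sub, map_add, map_mul, aeval_C, aeval_X, h0]
    rw [mul_zero, sub_zero, ← hr2]
  have hpn : p.coeff (n + 1) = 1 := by rw [← hn]; exact hmon.coeff_natDegree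
  have hcoef : ∀ m, q.coeff m = dF (p.coeff m) + (α * (p.coeff m * m) + γ * (p.coeff (m+1) * (m+1)))
      - (n + 1) * α * p.coeff m := by
    intro m
    have : derivative p * (C α * X + C γ) = C α * (derivative p * X) + C γ * derivative p := by ring
    rw [hq, this]
    simp only [coeff_sub, coeff_add, coeff_C_mul, hr1, coeff_derivative]
    cases m with
    | zero => simp
    | succ m => simp [coeff_mul_X, coeff_derivative]
  have hdeg : q.natDegree < p.natDegree := by
    rw [hn, Nat.lt_succ_iff, Polynomial.natDegree_le_iff_coeff_eq_zero]
    intro m hm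
    rw [hcoef]
    have h1 : p.coeff (m + 1) = 0 := Polynomial.coeff_eq_zero_of_natDegree_lt (by omega)
    rcases Nat.lt_or_ge (n + 1) m with h2 | h2
    · have h3 : p.coeff m = 0 := Polynomial.coeff_eq_zero_of_natDegree_lt (by omega)
      simp [h1, h3, hzero]
    · have : m = n + 1 := by omega
      subst this
      rw [h1, hpn]; simp [hone]; ring
  have hqz : q = 0 := by
    by_contra hne
    have := Polynomial.natDegree_le_of_dvd (minpoly.dvd F h hq0) hne
    rw [← hp] at this
    omega
  have hc := hcoef n
  rw [hqz, coeff_zero, hpn] at hc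
  have hne : (((n + 1 : ℕ) : F)) ≠ 0 := Nat.cast_ne_zero.2 (Nat.succ_ne_zero n)
  have hm := hmul ((n + 1 : ℕ) : F) (-(p.coeff n) / ((n + 1 : ℕ) : F))
  have hneg := hadd (p.coeff n) (-(p.coeff n))
  rw [add_neg_cancel, hzero] at hneg
  rw [hnat, mul_zero, add_zero, mul_div_cancel₀ _ hne] at hm
  refine ⟨-(p.coeff n) / ((n + 1 : ℕ) : F), ?_⟩
  apply mul_left_cancel₀ hne
  rw [← hm]
  have h2 : ((n + 1 : ℕ) : F) * (-(p.coeff n) / ((n + 1 : ℕ) : F)) = - p.coeff n :=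
    mul_div_cancel₀ _ hne
  push_cast at *
  linear_combination (-1 : F) * hneg + hc - α * h2

section core
variable {k E : Type*} [Field k] [Field E] [Algebra k E]

/-- The exact form `df`. -/
def evF (k : Type*) {E : Type*} [Field k] [Field E] [Algebra k E] (f : E) :
    Module.Dual E (Derivation k E E) where
  toFun Y := Y f
  map_add' _ _ := rfl
  map_smul' _ _ := rfl

@[simp] theorem evF_apply (f : E) (Y : Derivation k E E) : evF k f Y = Y f := rfl

/-- Closed one-forms. -/
def ClosedF (σ : Module.Dual E (Derivation k E E)) : Prop :=
  ∀ Y Z : Derivation k E E, σ ⁅Y, Z⁆ = Y (σ Z) - Z (σ Y)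

theorem closed_evF (f : E) : ClosedF (evF k f) := fun Y Z => by
  simp [Derivation.commutator_apply]

theorem closed_dlog (f : E) : ClosedF (f⁻¹ • evF k f) := fun Y Z => by
  simp only [LinearMap.smul_apply, evF_apply, Derivation.commutator_apply, smul_eq_mul,
    Derivation.leibniz, Derivation.leibniz_inv]
  ring

theorem ClosedF.add {σ τ : Module.Dual E (Derivation k E E)} (h1 : ClosedF σ) (h2 : ClosedF τ) :
    ClosedF (σ + τ) := fun Y Z => by
  simp only [LinearMap.add_apply, h1 Y Z, h2 Y Z, map_add]; ring

theorem ClosedF.sub {σ τ : Module.Dual E (Derivation k E E)} (h1 : ClosedF σ) (h2 : ClosedF τ) :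
    ClosedF (σ - τ) := fun Y Z => by
  simp only [LinearMap.sub_apply, h1 Y Z, h2 Y Z, map_sub]; ring

theorem ClosedF.const_smul {σ : Module.Dual E (Derivation k E E)} (h1 : ClosedF σ) (z : k) :
    ClosedF (algebraMap k E z • σ) := fun Y Z => by
  simp only [LinearMap.smul_apply, h1 Y Z, smul_eq_mul, Derivation.leibniz,
    Derivation.map_algebraMap]; ring

/-- Closed one-forms with constant value on `D`. -/
def S1 (D : Derivation k E E) : Set (Module.Dual E (Derivation k E E)) :=
  {σ | ClosedF σ ∧ ∃ z : k, σ D = algebraMap k E z}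

/-- Dilogarithmic one-forms. -/
def S2 (D : Derivation k E E) : Set (Module.Dual E (Derivation k E E)) :=
  {τ | τ D = 0 ∧ ∃ ω ∈ S1 D, ω D = 0 ∧ ∃ ζ, ClosedF ζ ∧
    ∀ Y Z, τ ⁅Y, Z⁆ = Y (τ Z) - Z (τ Y) + ω Y * ζ Z - ω Z * ζ Y}

theorem lemA {J : Type*} [Fintype J] (D X : Derivation k E E) (T : J → Derivation k E E)
    (ζ : J → Module.Dual E (Derivation k E E)) (hζ : ∀ j, ClosedF (ζ j))
    (hconst : ∀ y, D y = 0 → ∃ z, y = algebraMap k E z)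
    (hDT : ∀ j, ⁅D, T j⁆ = 0) (hDX : ⁅D, X⁆ = ∑ j, ζ j D • T j)
    (hTX : ∀ i, ⁅T i, X⁆ = ∑ j, ζ j (T i) • T j) (u : E)
    (hX : X (D u) = D u) (hT : ∀ j, T j (D u) = 0) (i : J) : T i u = 0 := by
  have hP : ∀ j, ∃ z, T j u = algebraMap k E z := fun j => hconst _ (by
    have := congrArg (fun Y : Derivation k E E => Y u) (hDT j)
    simp only [Derivation.commutator_apply, hT, sub_zero] at this
    simpa using this)
  choose P hP using hP
  have key : ∀ Y : Derivation k E E, ⁅Y, X⁆ = ∑ j, ζ j Y • T j →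
      (∀ j, ⁅T j, X⁆ = ∑ i, ζ i (T j) • T i) → 
      Y (X (X u) - ∑ j, algebraMap k E (P j) * ζ j X) = X (X (Y u)) := by
    intro Y hY _
    have comm : ∀ (Y : Derivation k E E), ⁅Y, X⁆ = ∑ j, ζ j Y • T j → ∀ w,
        Y (X w) = X (Y w) + ∑ j, ζ j Y * T j w := by
      intro Y hY w
      have := congrArg (fun Y : Derivation k E E => Y w) hY
      simp only [Derivation.commutator_apply] at this
      rw [← evF_apply (k := k) w (∑ j, ζ j Y • T j), map_sum] at this
      simp only [map_smul, evF_apply, smul_eq_mul] at this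
      rw [← this]; ring
    have e1 : Y (X u) = X (Y u) + ∑ j, ζ j Y * algebraMap k E (P j) := by
      rw [comm Y hY]; simp only [hP]
    have e2 : ∀ i, T i (X u) = ∑ j, ζ j (T i) * algebraMap k E (P j) := by
      intro i; rw [comm _ (hTX i)]; simp only [hP, Derivation.map_algebraMap, zero_add]
    have e3 : ∀ j, Y (ζ j X) = X (ζ j Y) + ∑ i, ζ i Y * ζ j (T i) := by
      intro j
      have := hζ j Y X
      rw [hY, map_sum] at this
      simp only [map_smul, smul_eq_mul] at this
      rw [this]; ring
    rw [map_sub, comm Y hY, e1, map_add, map_sum, map_sum]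
    simp only [e2, Derivation.leibniz, Derivation.map_algebraMap, smul_eq_mul, mul_zero, add_zero,
      zero_add, e3, mul_add, Finset.sum_add_distrib, Finset.mul_sum]
    rw [Finset.sum_comm (f := fun i j => ζ i Y * (ζ j (T i) * algebraMap k E (P j)))]
    have : ∀ x y, ζ y Y * (ζ x (T y) * algebraMap k E (P x)) 
      = algebraMap k E (P x) * (ζ y Y * ζ x (T y)) := by intros; ring
    simp only [this]
    ring
  set B := X (X u) - ∑ j, algebraMap k E (P j) * ζ j X
  have h1 : D (B - u) = 0 := by
    rw [map_sub, key D hDX hTX, hX, hX, sub_self]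
  obtain ⟨z, hz⟩ := hconst _ h1
  have h2 : T i B = 0 := by
    rw [key (T i) (hTX i) hTX, hP]; simp
  have h3 := congrArg (T i) hz
  rw [map_sub, h2, Derivation.map_algebraMap] at h3
  simpa using h3

theorem core (D : Derivation k E E) [FiniteDimensional E (Derivation k E E)]
    (hconst : ∀ y, D y = 0 → ∃ z, y = algebraMap k E z)
    (x t : E) (hx0 : x ≠ 0) (hDx : D x = x) (hDt : D t = 1)
    (Y1 Y2 : Derivation k E E) (hY1x : Y1 x = 0) (hY1t : Y1 t ≠ 0) (hY2x : Y2 x ≠ 0)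
    (hsep : ∀ Z, (∀ σ ∈ S1 D, σ Z = 0) → (∀ τ ∈ S2 D, τ Z = 0) → Z = 0)
    (u : E) (hf : ∀ Y : Derivation k E E, Y t = 0 → x * Y (D u) = Y x * D u) :
    ∀ Z : Derivation k E E, Z x = 0 → Z t = 0 → Z u = 0 := by
  classical
  set a : Module.Dual E (Derivation k E E) := evF k t with ha
  set b₀ : Module.Dual E (Derivation k E E) := x⁻¹ • evF k x with hb₀
  have haD : a D = 1 := hDt
  have hbD : b₀ D = 1 := by simp [hb₀, hDx, hx0]
  have ha1 : a ∈ S1 D := ⟨closed_evF t, 1, by rw [haD, map_one]⟩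
  have hb1 : b₀ ∈ S1 D := ⟨closed_dlog x, 1, by rw [hbD, map_one]⟩
  have hbY2 : b₀ Y2 ≠ 0 := by simp [hb₀, hY2x, hx0]
  have hbY1 : b₀ Y1 = 0 := by simp [hb₀, hY1x]
  have haY1 : a Y1 ≠ 0 := hY1t
  have hab : a ≠ b₀ := fun h => haY1 (by rw [h, hbY1])
  have hind : LinearIndepOn E id ({a, b₀} : Set (Module.Dual E (Derivation k E E))) := by
    rw [LinearIndepOn.pair_iff _ hab]
    intro r s hrs
    have h1 := congrArg (fun φ : Module.Dual E (Derivation k E E) => φ Y1) hrs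
    have h2 := congrArg (fun φ : Module.Dual E (Derivation k E E) => φ Y2) hrs
    simp only [id, LinearMap.add_apply, LinearMap.smul_apply, smul_eq_mul, hbY1, mul_zero,
      add_zero, LinearMap.zero_apply, mul_eq_zero, haY1, or_false] at h1
    subst h1
    simp only [id, LinearMap.add_apply, LinearMap.smul_apply, smul_eq_mul, zero_mul, zero_add,
      LinearMap.zero_apply, mul_eq_zero, hbY2, or_false] at h2
    exact ⟨rfl, h2⟩
  obtain ⟨b, hbS, hab_b, hSb, hbi⟩ := exists_linearIndepOn_id_extension hind
    (t := S1 D) (by rintro _ (rfl | rfl) <;> assumption)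
  obtain ⟨b', hb'S, hbb', hSb', hb'i⟩ := exists_linearIndepOn_id_extension hbi
    (t := b ∪ S2 D) Set.subset_union_left
  have hspan_zero : ∀ (s : Set (Module.Dual E (Derivation k E E))) (Z : Derivation k E E),
      (∀ φ ∈ s, φ Z = 0) → ∀ φ ∈ Submodule.span E s, φ Z = 0 := by
    intro s Z hs φ hφ
    induction hφ using Submodule.span_induction with
    | mem φ h => exact hs φ h
    | zero => rfl
    | add φ ψ _ _ h1 h2 => simp [h1, h2]
    | smul r φ _ h => simp [h]
  have hsep' : ∀ Z, (∀ φ ∈ b', φ Z = 0) → Z = 0 := by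
    intro Z hZ
    have h := hspan_zero b' Z hZ
    refine hsep Z ?_ ?_
    · intro σ hσ
      exact hspan_zero b Z (fun φ hφ => hZ φ (hbb' hφ)) σ (hSb hσ)
    · intro τ hτ
      exact h τ (hSb' (Or.inr hτ))
  have hfin : Finite b' := hb'i.setFinite
  have : Fintype b' := Fintype.ofFinite _
  -- dual vectors
  have hdual : ∀ φ : b', ∃ V : Derivation k E E, ∀ ψ : b', (ψ : Module.Dual E _) V =
      if ψ = φ then 1 else 0 := by
    intro φ
    have hli : LinearIndependent E (fun ψ : b' => (ψ : Module.Dual E (Derivation k E E))) := hb'i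
    obtain ⟨g, hg⟩ := (LinearMap.exists_extend
      ((Finsupp.lapply φ : (b' →₀ E) →ₗ[E] E).comp hli.repr))
    refine ⟨(Module.evalEquiv E (Derivation k E E)).symm g, fun ψ => ?_⟩
    have h1 : (ψ : Module.Dual E (Derivation k E E))
        ((Module.evalEquiv E (Derivation k E E)).symm g) = g ψ := by
      have := Module.apply_evalEquiv_symm_apply (R := E) (M := Derivation k E E) ψ.1 g
      exact this
    rw [h1]
    have hmem : (ψ : Module.Dual E (Derivation k E E)) ∈
      Submodule.span E (Set.range (fun ψ : b' => (ψ : Module.Dual E (Derivation k E E)))) :=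
      Submodule.subset_span ⟨ψ, rfl⟩
    have h2 := congrArg (fun l => l ⟨_, hmem⟩) hg
    simp only [LinearMap.comp_apply, Submodule.subtype_apply] at h2
    rw [h2, hli.repr_eq_single ψ _ rfl]
    simp [Finsupp.single_apply]
  choose V hV using hdual
  let J := {φ : b' // (φ : Module.Dual E (Derivation k E E)) ∉ b}
  let T : J → Derivation k E E := fun j => V j.1
  have expand : ∀ Z : Derivation k E E, (∀ e ∈ b, e Z = 0) → Z = ∑ j : J, j.1.1 Z • T j := by
    intro Z hZ
    rw [← sub_eq_zero]
    apply hsep'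
    intro φ hφ
    rw [map_sub, map_sum, sub_eq_zero]
    simp only [map_smul, smul_eq_mul]
    by_cases hφb : φ ∈ b
    · rw [hZ φ hφb, Finset.sum_eq_zero]
      intro j _
      have := hV j.1 ⟨φ, hφ⟩
      rw [if_neg (by rintro h; exact j.2 (h ▸ hφb))] at this
      simp only at this
      rw [this, mul_zero]
    · rw [Finset.sum_eq_single (⟨⟨φ, hφ⟩, hφb⟩ : J)]
      · have := hV ⟨φ, hφ⟩ ⟨φ, hφ⟩
        rw [if_pos rfl] at this
        simp only at this
        rw [this, mul_one]
      · intro j _ hj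
        have := hV j.1 ⟨φ, hφ⟩
        rw [if_neg (fun h => hj (Subtype.ext h.symm))] at this
        simp only at this
        rw [this, mul_zero]
      · simp
  have hJ : ∀ j : J, j.1.1 ∈ S2 D := fun j => (hb'S j.1.2).resolve_left j.2
  have hD0 : ∀ j : J, j.1.1 D = 0 := fun j => (hJ j).1
  choose ω hω1 hωD ζ hζ hstr using fun j : J => (hJ j).2
  have hS1D : ∀ σ ∈ S1 D, ∀ Y : Derivation k E E, σ ⁅D, Y⁆ = D (σ Y) := by
    rintro σ ⟨hσ, z, hz⟩ Y
    rw [hσ, hz, Derivation.map_algebraMap, sub_zero]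
  -- values of basis elements on dual vectors
  have hVb : ∀ e ∈ b, ∀ j : J, e (T j) = 0 := by
    intro e he j
    have := hV j.1 ⟨e, hbb' he⟩
    rw [if_neg (by rintro h; exact j.2 (h ▸ he))] at this
    exact this
  have hVconst : ∀ φ ψ : b', ∀ Y : Derivation k E E, Y (ψ.1 (V φ)) = 0 := by
    intro φ ψ Y
    rw [hV φ ψ]; split_ifs <;> simp
  have hS1T : ∀ σ ∈ S1 D, ∀ j, σ (T j) = 0 := fun σ hσ j =>
    hspan_zero b _ (fun e he => hVb e he j) σ (hSb hσ)
  have hN : ∀ φ : b', ∀ e ∈ b, e ⁅D, V φ⁆ = 0 := by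
    intro φ e he
    rw [hS1D e (hbS he), hVconst φ ⟨e, hbb' he⟩]
  have hN2 : ∀ φ ψ : b', ∀ e ∈ b, e ⁅V φ, V ψ⁆ = 0 := by
    intro φ ψ e he
    rw [(hbS he).1, hVconst ψ ⟨e, hbb' he⟩, hVconst φ ⟨e, hbb' he⟩, sub_zero]
  let φx : b' := ⟨b₀, hbb' (hab_b (by simp))⟩
  let φt : b' := ⟨a, hbb' (hab_b (by simp))⟩
  set X := V φx with hXdef
  have hDT : ∀ j, ⁅D, T j⁆ = 0 := by
    intro j
    rw [expand _ (hN j.1)]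
    apply Finset.sum_eq_zero
    intro i _
    rw [hstr, hVconst, hD0, hωD, hS1T _ (hω1 i)]
    simp
  have hκ : ∀ j, ∃ z, ω j X = algebraMap k E z := fun j => hconst _ (by
    rw [← hS1D _ (hω1 j)]
    exact hspan_zero b _ (hN φx) _ (hSb (hω1 j)))
  choose κ hκ using hκ
  have hXx : X x = x := by
    have := hV φx φx
    rw [if_pos rfl] at this
    have h2 : x⁻¹ * X x = 1 := this
    field_simp at h2
    exact h2
  have hXt : X t = 0 := by
    have := hV φx φt
    rw [if_neg (fun h => hab (congrArg Subtype.val h))] at this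
    exact this
  have hVx : ∀ φ : b', φ ≠ φx → V φ x = 0 := by
    intro φ hφ
    have := hV φ φx
    rw [if_neg (fun h => hφ h.symm)] at this
    have h2 : x⁻¹ * V φ x = 0 := this
    simpa [hx0] using h2
  have hVt : ∀ φ : b', φ ≠ φt → V φ t = 0 := by
    intro φ hφ
    have := hV φ φt
    rw [if_neg (fun h => hφ h.symm)] at this
    exact this
  have hVf : ∀ φ : b', φ ≠ φx → φ ≠ φt → V φ (D u) = 0 := by
    intro φ h1 h2
    have := hf (V φ) (hVt φ h2)
    rw [hVx φ h1, zero_mul, mul_eq_zero] at this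
    exact this.resolve_left hx0
  have hXf : X (D u) = D u := by
    have := hf X hXt
    rw [hXx] at this
    exact mul_left_cancel₀ hx0 this
  have hJx : ∀ j : J, j.1 ≠ φx := fun j h => j.2 (by rw [h]; exact hab_b (by simp [φx]))
  have hJt : ∀ j : J, j.1 ≠ φt := fun j h => j.2 (by rw [h]; exact hab_b (by simp [φt]))
  have hTu : ∀ j, T j u = 0 := by
    refine lemA D X T (fun j => algebraMap k E (-κ j) • ζ j) (fun j => (hζ j).const_smul _) hconst
      hDT ?_ ?_ u hXf (fun j => hVf j.1 (hJx j) (hJt j))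
    · conv_lhs => rw [expand _ (hN φx)]
      refine Finset.sum_congr rfl fun j _ => ?_
      rw [hstr, hVconst, hD0, hωD, hκ]
      simp
    · intro i
      conv_lhs => rw [expand _ (hN2 i.1 φx)]
      refine Finset.sum_congr rfl fun j _ => ?_
      rw [hstr, hVconst, hVconst, hκ, hS1T _ (hω1 j)]
      simp [T]
  have hNu : ∀ Z : Derivation k E E, (∀ e ∈ b, e Z = 0) → Z u = 0 := by
    intro Z hZ
    rw [expand Z hZ, ← evF_apply (k := k) u, map_sum]
    apply Finset.sum_eq_zero
    intro j _
    rw [map_smul, evF_apply, hTu, smul_zero]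
  have hXu : D (X u - u) = 0 := by
    have := hNu _ (hN φx)
    rw [Derivation.commutator_apply, sub_eq_zero] at this
    rw [map_sub, this, hXf, sub_self]
  obtain ⟨z, hz⟩ := hconst _ hXu
  have hVu : ∀ φ : b', φ ≠ φx → φ ≠ φt → V φ u = 0 := by
    intro φ h1 h2
    have e1 := hNu _ (hN φ)
    rw [Derivation.commutator_apply, hVf φ h1 h2, sub_zero] at e1
    obtain ⟨w, hw⟩ := hconst _ e1
    have e2 := hNu _ (hN2 φ φx)
    rw [Derivation.commutator_apply, hw, Derivation.map_algebraMap, sub_zero] at e2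
    have e3 := congrArg (V φ) hz
    rw [map_sub, e2, Derivation.map_algebraMap, zero_sub, neg_eq_zero] at e3
    exact e3
  intro Z hZx hZt
  have hZ : Z = ∑ φ : b', φ.1 Z • V φ := by
    rw [← sub_eq_zero]
    apply hsep'
    intro φ hφ
    rw [map_sub, map_sum, sub_eq_zero]
    simp only [map_smul, smul_eq_mul]
    rw [Finset.sum_eq_single (⟨φ, hφ⟩ : b')]
    · have := hV ⟨φ, hφ⟩ ⟨φ, hφ⟩
      rw [if_pos rfl] at this
      simp only at this
      rw [this, mul_one]
    · intro j _ hj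
      have := hV j ⟨φ, hφ⟩
      rw [if_neg (fun h => hj h.symm)] at this
      simp only at this
      rw [this, mul_zero]
    · simp
  rw [hZ, ← evF_apply (k := k) u, map_sum]
  apply Finset.sum_eq_zero
  intro φ _
  rw [map_smul, evF_apply, smul_eq_mul]
  by_cases h1 : φ = φx
  · have : φ.1 Z = 0 := by
      rw [h1]; change x⁻¹ * Z x = 0; rw [hZx, mul_zero]
    rw [this, zero_mul]
  · by_cases h2 : φ = φt
    · have : φ.1 Z = 0 := by rw [h2]; exact hZt
      rw [this, zero_mul]
    · rw [hVu φ h1 h2, mul_zero]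
end core

/-- The field of elements killed by a derivation. -/
def kerField {k E : Type*} [Field k] [Field E] [Algebra k E] (Y : Derivation k E E) :
    Subfield E where
  carrier := {e | Y e = 0}
  mul_mem' := by
    intro a b ha hb
    simp only [Set.mem_ofPred_eq] at *
    simp [ha, hb]
  one_mem' := by simp
  add_mem' := by
    intro a b ha hb
    simp only [Set.mem_ofPred_eq] at *
    simp [ha, hb]
  zero_mem' := by simp
  neg_mem' := by
    intro a ha
    simp only [Set.mem_ofPred_eq] at *
    simp [ha]
  inv_mem' := by
    intro a ha
    simp only [Set.mem_ofPred_eq] at *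
    simp [Derivation.leibniz_inv, ha]

theorem mem_kerField {k E : Type*} [Field k] [Field E] [Algebra k E] (Y : Derivation k E E) (e : E) :
    e ∈ kerField Y ↔ Y e = 0 := Iff.rfl

theorem to_der {k K E : Type*} [Field k] [Field K] [Field E] [Algebra k E] [Algebra K E]
    (Y : Derivation K E E) (h : ∀ z : k, ∃ κ : K, algebraMap k E z = algebraMap K E κ) :
    ∃ Y' : Derivation k E E, ∀ e, Y' e = Y e := by
  refine ⟨Derivation.mk'
    { toFun := fun e => Y e
      map_add' := fun a b => map_add Y a b
      map_smul' := fun z e => ?_ } ?_, fun e => rfl⟩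
  · obtain ⟨κ, hκ⟩ := h z
    simp [Algebra.smul_def, hκ]
  · intro a b
    exact Y.leibniz a b

theorem exists_der_subfield {k F E : Type*} [Field k] [Field F] [Field E] [Algebra k E] [CharZero E]
    (c : k →+* F) (ι : F →+* E) (hk : ∀ z, algebraMap k E z = ι (c z)) (S : Subfield F)
    (hcS : ∀ z, c z ∈ S) (a : F) (ha : Transcendental S a) :
    ∃ Y : Derivation k E E, (∀ s ∈ S, Y (ι s) = 0) ∧ Y (ι a) ≠ 0 := by
  letI : Algebra F E := ι.toAlgebra
  have h1 : Transcendental S (ι a) :=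
    (transcendental_algebraMap_iff (A := E) (algebraMap F E).injective).2 ha
  obtain ⟨Y, hY⟩ := exists_der_ne_zero (ι a) h1
  obtain ⟨Y', hY'⟩ := to_der (k := k) Y (fun z => ⟨⟨c z, hcS z⟩, by rw [hk]; rfl⟩)
  refine ⟨Y', fun s hs => ?_, by rwa [hY']⟩
  rw [hY']
  exact Y.map_algebraMap (⟨s, hs⟩ : S)

theorem exists_D {k F E : Type*} [Field k] [Field F] [CharZero F] [Field E] [CharZero E]
    [Algebra k E] (c : k →+* F) (ι : F →+* E) (hk : ∀ z, algebraMap k E z = ι (c z))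
    (δF : Derivation ℚ F F) (δE : Derivation ℚ E E) (hc : ∀ a, δF (c a) = 0)
    (hcomp : ∀ y : F, δE (ι y) = ι (δF y)) (x : E) :
    ∃ D : Derivation k E E, ∀ e, D e = x * δE e := by
  refine ⟨Derivation.mk'
    { toFun := fun e => x * δE e
      map_add' := fun a b => by rw [map_add, mul_add]
      map_smul' := fun z e => ?_ } ?_, fun e => rfl⟩
  · simp [Algebra.smul_def, hk, hcomp, hc]
    ring
  · intro a b
    simp [Derivation.leibniz]
    ring

theorem ker_all {k F E : Type*} [Field k] [Field F] [Field E] [Algebra k E]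
    (c : k →+* F) (ι : F →+* E) (hk : ∀ z, algebraMap k E z = ι (c z)) (x L : F)
    (hgen : Subfield.closure (Set.range ⇑c ∪ {x, L}) = ⊤) (Y : Derivation k E E)
    (hx : Y (ι x) = 0) (hL : Y (ι L) = 0) (y : F) : Y (ι y) = 0 := by
  have : (⊤ : Subfield F) ≤ (kerField Y).comap ι := by
    rw [← hgen, Subfield.closure_le]
    rintro _ (⟨z, rfl⟩ | rfl | rfl)
    · change Y (ι (c z)) = 0
      rw [← hk]; simp
    · exact hx
    · exact hL
  exact this (Subfield.mem_top y)

theorem main_aux {F : Type u} [Field F] [CharZero F] (δF : Derivation ℚ F F)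
    (c : ℂ →+* F) (x L : F)
    (hc : ∀ a : ℂ, δF (c a) = 0) (hx : δF x = 1) (hL : δF L = x⁻¹)
    (hxtr : Transcendental (↥(Subfield.closure (Set.range ⇑c))) x)
    (hLtr : Transcendental (↥(Subfield.closure (Set.range ⇑c ∪ {x}))) L)
    (hgen : Subfield.closure (Set.range ⇑c ∪ {x, L}) = ⊤)
    (q : F) (hq : q ∈ Subfield.closure (Set.range ⇑c ∪ {L}))
    (E : Type v) [Field E] [CharZero E] (δE : Derivation ℚ E E)
    (ι : F →+* E)
    (hcomp : ∀ y : F, δE (ι y) = ι (δF y))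
    (hconst : ∀ y : E, δE y = 0 → ∃ z : ℂ, y = ι (c z))
    (n : ℕ) (θ : Fin n → E) (htow : IsTransDilogElemTower δE ι.fieldRange θ)
    (u : E) (hu : δE u = ι q) : ∃ w : F, δF w = q := by
  letI : Algebra ℂ E := (ι.comp c).toAlgebra
  have hk : ∀ z, algebraMap ℂ E z = ι (c z) := fun z => rfl
  have hx0 : x ≠ 0 := by rintro rfl; simp at hx
  have hιx0 : ι x ≠ 0 := by simpa using hx0
  obtain ⟨D, hD⟩ := exists_D c ι hk δF δE hc hcomp (ι x)
  obtain ⟨Y1, hY1, hY1L⟩ := exists_der_subfield c ι hk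
    (Subfield.closure (Set.range ⇑c ∪ {x}))
    (fun z => Subfield.subset_closure (Or.inl ⟨z, rfl⟩)) L hLtr
  obtain ⟨Y2, -, hY2x⟩ := exists_der_subfield c ι hk
    (Subfield.closure (Set.range ⇑c)) (fun z => Subfield.subset_closure ⟨z, rfl⟩) x hxtr
  have hall := ker_all c ι hk x L hgen
  -- a derivation killing everything is zero
  have hzero : ∀ Y : Derivation ℂ E E, Y (ι x) = 0 → Y (ι L) = 0 → (∀ i, Y (θ i) = 0) → Y = 0 := by
    intro Y h1 h2 h3
    have : (⊤ : Subfield E) ≤ kerField Y := by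
      rw [← htow.2, Subfield.closure_le]
      rintro _ (⟨y, rfl⟩ | ⟨i, rfl⟩)
      · exact hall Y h1 h2 y
      · exact h3 i
    ext e
    exact this (Subfield.mem_top e)
  have hfd : FiniteDimensional E (Derivation ℂ E E) := by
    let l : Derivation ℂ E E →ₗ[E] ((Fin n → E) × E × E) :=
      (LinearMap.pi fun i => evF ℂ (θ i)).prod ((evF ℂ (ι x)).prod (evF ℂ (ι L)))
    refine Module.Finite.of_injective l ?_
    rw [injective_iff_map_eq_zero]
    intro Y hY
    have h1 : (fun i => Y (θ i), Y (ι x), Y (ι L)) = ((0 : Fin n → E), (0 : E), (0 : E)) := hY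
    simp only [Prod.mk.injEq] at h1
    exact hzero Y h1.2.1 h1.2.2 (fun i => congrFun h1.1 i)
  have hDx : D (ι x) = ι x := by rw [hD, hcomp, hx, map_one, mul_one]
  have hDL : D (ι L) = 1 := by rw [hD, hcomp, hL, map_inv₀, mul_inv_cancel₀ hιx0]
  have hDu : D u = ι x * ι q := by rw [hD, hu]
  have hqY : ∀ Y : Derivation ℂ E E, Y (ι L) = 0 → Y (ι q) = 0 := by
    intro Y hY
    have : Subfield.closure (Set.range ⇑c ∪ {L}) ≤ (kerField Y).comap ι := by
      rw [Subfield.closure_le]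
      rintro _ (⟨z, rfl⟩ | rfl)
      · change Y (ι (c z)) = 0
        rw [← hk]; simp
      · exact hY
    exact this hq
  have hS1 : ∀ σ : Module.Dual E (Derivation ℂ E E), ClosedF σ → σ D = 0 → σ ∈ S1 D :=
    fun σ h1 h2 => ⟨h1, 0, by rw [h2, map_zero]⟩
  have hres := core D
    (fun y hy => hconst y (by rw [hD] at hy; exact (mul_eq_zero.1 hy).resolve_left hιx0))
    (ι x) (ι L) hιx0 hDx hDL Y1 Y2 (hY1 x (Subfield.subset_closure (Or.inr rfl))) hY1L hY2x ?_ u ?_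
  · -- conclusion
    letI : Algebra F E := ι.toAlgebra
    have halg : IsAlgebraic F u := by
      by_contra hna
      obtain ⟨Y, hY⟩ := exists_der_ne_zero (K := F) u hna
      obtain ⟨Y', hY'⟩ := to_der (k := ℂ) Y (fun z => ⟨c z, rfl⟩)
      apply hY
      rw [← hY']
      exact hres Y' (by rw [hY']; exact Y.map_algebraMap x) (by rw [hY']; exact Y.map_algebraMap L)
    obtain ⟨g, hg⟩ := alg_descend (F := F) (fun y => δF y) δE hcomp 0 q u
      (by rw [map_zero, zero_mul, zero_add]; exact hu) halg
    exact ⟨g, by rw [hg]; ring⟩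
  · intro Z hZ1 hZ2
    have hZL : Z (ι L) = 0 := hZ1 (evF ℂ (ι L)) ⟨closed_evF _, 1, by simp [hDL]⟩
    have hZx : Z (ι x) = 0 := by
      have := hZ1 ((ι x)⁻¹ • evF ℂ (ι x)) ⟨closed_dlog _, 1, by simp [hDx, hx0]⟩
      simpa [hx0] using this
    refine hzero Z hZx hZL ?_
    have hstep : ∀ m : ℕ, ∀ i : Fin n, i.1 = m → Z (θ i) = 0 := by
      intro m
      induction m using Nat.strong_induction_on with
      | _ m ih =>
      intro i him
      have hB : Subfield.closure ((ι.fieldRange : Set E) ∪ θ '' {j : Fin n | j < i})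
          ≤ kerField Z := by
        rw [Subfield.closure_le]
        rintro _ (⟨y, rfl⟩ | ⟨j, hj, rfl⟩)
        · exact hall Z hZx hZL y
        · exact ih j.1 (by rw [← him]; exact hj) j rfl
      obtain ⟨htr, hcase⟩ := htow.1 i
      have hθ0 : θ i ≠ 0 := by
        intro h
        rw [h] at htr
        exact htr isAlgebraic_zero
      rcases hcase with ⟨a, haB, ha⟩ | ⟨a, haB, ha0, ha⟩ | ⟨g, hgB, hg0, hg1, η, hηB, hη, hd⟩
      · have hZa : Z a = 0 := hB haB
        have := hZ1 ((θ i)⁻¹ • evF ℂ (θ i) - evF ℂ a)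
          (hS1 _ ((closed_dlog _).sub (closed_evF _)) (by
            simp only [LinearMap.sub_apply, LinearMap.smul_apply, evF_apply, smul_eq_mul, hD, ha]
            field_simp
            ring))
        simpa [hZa, hθ0] using this
      · have hZa : Z a = 0 := hB haB
        have := hZ1 (evF ℂ (θ i) - a⁻¹ • evF ℂ a)
          (hS1 _ ((closed_evF _).sub (closed_dlog _)) (by
            simp only [LinearMap.sub_apply, LinearMap.smul_apply, evF_apply, smul_eq_mul, hD, ha]
            field_simp
            ring))
        simpa [hZa] using this
      · have hZg : Z g = 0 := hB hgB
        have hg1' : 1 - g ≠ 0 := sub_ne_zero.2 (Ne.symm hg1)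
        have hωD : (evF ℂ η + (1 - g)⁻¹ • evF ℂ (1 - g)) D = 0 := by
          simp only [LinearMap.add_apply, LinearMap.smul_apply, evF_apply, smul_eq_mul, hD, hη]
          field_simp
          ring
        have := hZ2 (evF ℂ (θ i) - η • (g⁻¹ • evF ℂ g)) ⟨by
            simp only [LinearMap.sub_apply, LinearMap.smul_apply, evF_apply, smul_eq_mul, hD, hd]
            field_simp
            ring, evF ℂ η + (1 - g)⁻¹ • evF ℂ (1 - g),
          hS1 _ ((closed_evF _).add (closed_dlog _)) hωD, hωD, g⁻¹ • evF ℂ g, closed_dlog g, by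
            intro Y W
            rw [LinearMap.sub_apply, LinearMap.smul_apply, closed_dlog g Y W, closed_evF (θ i) Y W]
            simp only [LinearMap.add_apply, LinearMap.sub_apply, LinearMap.smul_apply, evF_apply,
              smul_eq_mul, map_sub, Derivation.leibniz, Derivation.map_one_eq_zero]
            ring⟩
        simpa [hZg] using this
    exact fun i => hstep i.1 i rfl
  · intro Y hY
    rw [hDu, Derivation.leibniz, hqY Y hY]
    simp only [smul_eq_mul]
    ring

theorem poly_no (r s : Polynomial ℂ) (hrs : IsCoprime r s) (hs : s ≠ 0)
    (h : (Polynomial.derivative r * s - r * Polynomial.derivative s + r * s) * Polynomial.X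
      = s ^ 2) : False := by
  obtain ⟨s1, hs1, hnd⟩ := Polynomial.exists_eq_pow_rootMultiplicity_mul_and_not_dvd s hs 0
  generalize s.rootMultiplicity 0 = m at hs1
  simp only [Polynomial.C_0, sub_zero] at hs1 hnd
  rcases Nat.eq_zero_or_pos m with rfl | hm
  · apply hnd
    have : s = s1 := by simpa using hs1
    rw [← this]
    exact Polynomial.prime_X.dvd_of_dvd_pow (n := 2) (h ▸ Dvd.intro_left _ rfl)
  · obtain ⟨m, rfl⟩ : ∃ k, m = k + 1 := ⟨m - 1, by omega⟩
    have hd : Polynomial.derivative s = ((m : Polynomial ℂ) + 1) * Polynomial.X ^ m * s1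
        + Polynomial.X ^ (m + 1) * Polynomial.derivative s1 := by
      rw [hs1]
      simp [Polynomial.derivative_mul, Polynomial.derivative_X_pow]
    have h2 : Polynomial.X ^ (m + 1) * ((Polynomial.derivative r * s1 * Polynomial.X
        - r * ((m : Polynomial ℂ) + 1) * s1 - r * Polynomial.derivative s1 * Polynomial.X
        + r * s1 * Polynomial.X)) = Polynomial.X ^ (m + 1) * (Polynomial.X ^ (m + 1) * s1 ^ 2) := by
      rw [hd, hs1] at h
      linear_combination h
    have h3 := mul_left_cancel₀ (pow_ne_zero _ Polynomial.X_ne_zero) h2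
    have h4 := congrArg (Polynomial.eval 0) h3
    simp only [Polynomial.eval_add, Polynomial.eval_sub, Polynomial.eval_mul, Polynomial.eval_X,
      Polynomial.eval_pow, Polynomial.eval_natCast, Polynomial.eval_one, mul_zero, zero_sub,
      sub_zero, add_zero, ne_eq, Nat.succ_ne_zero, not_false_eq_true, zero_pow, zero_mul,
      neg_eq_zero, mul_eq_zero, Nat.cast_add_one_ne_zero, or_false] at h4
    rcases h4 with h4 | h4
    · obtain ⟨a, b, hab⟩ := hrs
      have := congrArg (Polynomial.eval 0) hab
      rw [hs1] at this
      simp [h4] at this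
    · apply hnd
      rw [Polynomial.X_dvd_iff, Polynomial.coeff_zero_eq_eval_zero, h4]

theorem no_inv {F : Type u} [Field F] [CharZero F] (δF : Derivation ℚ F F)
    (c : ℂ →+* F) (x L : F)
    (hc : ∀ a : ℂ, δF (c a) = 0) (hx : δF x = 1) (hL : δF L = x⁻¹)
    (hxtr : Transcendental (↥(Subfield.closure (Set.range ⇑c))) x)
    (hLtr : Transcendental (↥(Subfield.closure (Set.range ⇑c ∪ {x}))) L)
    (hgen : Subfield.closure (Set.range ⇑c ∪ {x, L}) = ⊤)
    (hconst : ∀ a : F, δF a = 0 → ∃ z : ℂ, a = c z) (w : F) (hw : δF w = L⁻¹) : False := by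
  let : Algebra ℂ F := c.toAlgebra
  have hk : ∀ z, algebraMap ℂ F z = RingHom.id F (c z) := fun z => rfl
  have hk' : ∀ z, algebraMap ℂ F z = c z := fun z => rfl
  have hx0 : x ≠ 0 := by rintro rfl; simp at hx
  obtain ⟨D, hD⟩ := exists_D c (RingHom.id F) hk δF δF hc (fun y => rfl) x
  obtain ⟨Y1, hY1, hY1L⟩ := exists_der_subfield c (RingHom.id F) hk
    (Subfield.closure (Set.range ⇑c ∪ {x}))
    (fun z => Subfield.subset_closure (Or.inl ⟨z, rfl⟩)) L hLtr
  obtain ⟨Y2, -, hY2x⟩ := exists_der_subfield c (RingHom.id F) hk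
    (Subfield.closure (Set.range ⇑c)) (fun z => Subfield.subset_closure ⟨z, rfl⟩) x hxtr
  have hY1x : Y1 x = 0 := hY1 x (Subfield.subset_closure (Or.inr rfl))
  simp only [RingHom.id_apply] at hY1L hY2x
  have hall : ∀ Y : Derivation ℂ F F, Y x = 0 → Y L = 0 → ∀ y, Y y = 0 :=
    ker_all c (RingHom.id F) hk x L hgen
  have hDx : D x = x := by rw [hD, hx, mul_one]
  have hDL : D L = 1 := by rw [hD, hL, mul_inv_cancel₀ hx0]
  have hDw : D w = x * L⁻¹ := by rw [hD, hw]
  obtain ⟨X, hXx, hXL⟩ : ∃ X : Derivation ℂ F F, X x = x ∧ X L = 0 := by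
    refine ⟨(x / Y2 x) • (Y2 - (Y2 L / Y1 L) • Y1), ?_, ?_⟩
    · simp only [Derivation.smul_apply, Derivation.sub_apply, smul_eq_mul, hY1x]
      field_simp
      ring
    · simp only [Derivation.smul_apply, Derivation.sub_apply, smul_eq_mul]
      field_simp
      ring
  have hbr : ∀ y, D (X y) = X (D y) := by
    intro y
    have := hall ⁅D, X⁆ (by simp [Derivation.commutator_apply, hXx, hDx])
      (by simp [Derivation.commutator_apply, hXL, hDL]) y
    rw [Derivation.commutator_apply] at this
    exact sub_eq_zero.1 this
  have hXw : X (D w) = D w := by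
    rw [hDw, Derivation.leibniz, Derivation.leibniz_inv, hXL, hXx]
    simp [mul_comm]
  obtain ⟨z, hz⟩ := hconst (X w - w) (by
    have : D (X w - w) = 0 := by rw [map_sub, hbr, hXw, sub_self]
    rw [hD] at this
    exact (mul_eq_zero.1 this).resolve_left hx0)
  have hDc : D (c z) = 0 := by rw [← hk']; simp
  have hXc : X (c z) = 0 := by rw [← hk']; simp
  have hXw' : X w = w + c z := by rw [← hz]; ring
  obtain ⟨h, hh⟩ : ∃ h, h = (w + c z) * x⁻¹ := ⟨_, rfl⟩
  have hXh : X h = 0 := by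
    rw [hh, Derivation.leibniz, Derivation.leibniz_inv, map_add, hXw', hXc, hXx]
    simp only [smul_eq_mul]
    field_simp
    ring
  have hDh : D h = -1 * h + L⁻¹ := by
    rw [hh, Derivation.leibniz, Derivation.leibniz_inv, map_add, hDw, hDc, hDx]
    simp only [smul_eq_mul]
    field_simp
    ring
  let K := IntermediateField.adjoin ℂ ({L} : Set F)
  have halg : IsAlgebraic K h := by
    by_contra hna
    obtain ⟨Z, hZ⟩ := exists_der_ne_zero (K := K) h hna
    obtain ⟨Z', hZ'⟩ := to_der (k := ℂ) Z (fun z => ⟨algebraMap ℂ K z, rfl⟩)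
    have hZL : Z' L = 0 := by
      rw [hZ']
      exact Z.map_algebraMap (⟨L, IntermediateField.mem_adjoin_simple_self ℂ L⟩ : K)
    have := hall (Z' - (Z' x / x) • X)
      (by simp [hXx, hx0]) (by simp [hXL, hZL]) h
    simp only [Derivation.sub_apply, Derivation.smul_apply, hXh, smul_zero, sub_zero] at this
    exact hZ (by rw [← hZ']; exact this)
  have hDp : ∀ p : Polynomial ℂ, D (Polynomial.aeval L p)
      = Polynomial.aeval L (Polynomial.derivative p) := by
    intro p
    rw [Derivation.map_aeval, hDL, smul_eq_mul, mul_one]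
  have hDK : ∀ y : K, ∃ y' : K, (y' : F) = D y := by
    rintro ⟨y, hy⟩
    obtain ⟨r, s, rfl⟩ := IntermediateField.mem_adjoin_simple_iff ℂ y |>.1 hy
    refine ⟨⟨_, ?_⟩, rfl⟩
    have hpK : ∀ p : Polynomial ℂ, Polynomial.aeval L p ∈ K := fun p =>
      IntermediateField.mem_adjoin_simple_iff ℂ _ |>.2 ⟨p, 1, by simp⟩
    simp only [div_eq_mul_inv, Derivation.leibniz, Derivation.leibniz_inv, hDp, smul_eq_mul]
    exact add_mem (mul_mem (hpK _) (mul_mem (neg_mem (pow_mem (inv_mem (hpK _)) _)) (hpK _)))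
      (mul_mem (inv_mem (hpK _)) (hpK _))
  choose dK hdK using hDK
  have hLK : L ∈ K := IntermediateField.mem_adjoin_simple_self ℂ L
  obtain ⟨g, hg⟩ := alg_descend (F := K) dK D (fun y => (hdK y).symm) (-1)
    (⟨L, hLK⟩⁻¹ : K) h (by
      rw [hDh, map_neg, map_one, map_inv₀]; rfl) halg
  have hg' : D (g : F) = -(g : F) + L⁻¹ := by
    rw [← hdK, hg]
    simp
  have hLC : Transcendental ℂ L := by
    intro halgL
    apply hLtr
    obtain ⟨p, hp, hpL⟩ := halgL
    let c' : ℂ →+* Subfield.closure (Set.range ⇑c ∪ {x}) :=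
      c.codRestrict _ (fun z => Subfield.subset_closure (Or.inl ⟨z, rfl⟩))
    refine ⟨p.map c', (Polynomial.map_ne_zero_iff c'.injective).2 hp, ?_⟩
    rw [Polynomial.aeval_def, Polynomial.eval₂_map]
    exact hpL
  have hinj : ∀ p : Polynomial ℂ, Polynomial.aeval L p = 0 → p = 0 :=
    fun p hp => (transcendental_iff.1 hLC) p hp
  have hL0 : L ≠ 0 := by
    intro h0
    exact Polynomial.X_ne_zero (hinj Polynomial.X (by simp [h0]))
  -- write g in lowest terms
  obtain ⟨r0, s0, hgrs⟩ := IntermediateField.mem_adjoin_simple_iff ℂ (g : F) |>.1 g.2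
  obtain ⟨r, s, hs0, hcop, hgr⟩ : ∃ r s : Polynomial ℂ, s ≠ 0 ∧ IsCoprime r s ∧
      (g : F) = Polynomial.aeval L r / Polynomial.aeval L s := by
    by_cases hs : s0 = 0
    · refine ⟨0, 1, one_ne_zero, isCoprime_one_right, ?_⟩
      rw [hgrs, hs]; simp
    · obtain ⟨r, hr⟩ := EuclideanDomain.gcd_dvd_left r0 s0
      obtain ⟨s, hs'⟩ := EuclideanDomain.gcd_dvd_right r0 s0
      have hd : EuclideanDomain.gcd r0 s0 ≠ 0 := by
        intro h0; rw [h0, zero_mul] at hs'; exact hs hs'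
      have hdL : Polynomial.aeval L (EuclideanDomain.gcd r0 s0) ≠ 0 := fun h0 => hd (hinj _ h0)
      refine ⟨r, s, ?_, ?_, ?_⟩
      · rintro rfl; rw [mul_zero] at hs'; exact hs hs'
      · have hb := EuclideanDomain.gcd_eq_gcd_ab r0 s0
        refine ⟨EuclideanDomain.gcdA r0 s0, EuclideanDomain.gcdB r0 s0,
          mul_left_cancel₀ hd ?_⟩
        calc _ = (EuclideanDomain.gcd r0 s0 * r) * EuclideanDomain.gcdA r0 s0
              + (EuclideanDomain.gcd r0 s0 * s) * EuclideanDomain.gcdB r0 s0 := by ring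
          _ = _ := by rw [← hr, ← hs', ← hb, mul_one]
      · have e1 := congrArg (Polynomial.aeval L) hr
        have e2 := congrArg (Polynomial.aeval L) hs'
        rw [map_mul] at e1 e2
        rw [hgrs, e1, e2, mul_div_mul_left _ _ hdL]
  have hsL : Polynomial.aeval L s ≠ 0 := fun h0 => hs0 (hinj _ h0)
  refine poly_no r s hcop hs0 (sub_eq_zero.1 (hinj _ ?_))
  rw [hgr, div_eq_mul_inv, Derivation.leibniz, Derivation.leibniz_inv, hDp, hDp] at hg'
  simp only [smul_eq_mul] at hg'
  field_simp at hg'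
  simp only [map_sub, map_add, map_mul, map_pow, Polynomial.aeval_X]
  linear_combination hg'

theorem eval_mem {F : Type u} [Field F] (c : ℂ →+* F) (L : F) (p : Polynomial ℂ) :
    Polynomial.eval₂ c L p ∈ Subfield.closure (Set.range ⇑c ∪ {L}) := by
  rw [Polynomial.eval₂_eq_sum, Polynomial.sum_def]
  refine sum_mem fun i _ => mul_mem ?_ (pow_mem ?_ _)
  · exact Subfield.subset_closure (Or.inl ⟨_, rfl⟩)
  · exact Subfield.subset_closure (Or.inr rfl)

/-- Theorem 3.3: let `F = ℂ(x, L)` with `x' = 1`, `L' = 1/x` and constants `ℂ`.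
If a non-constant `H ∈ ℂ(Y)` is such that `H(L)` has no antiderivative in `F`,
then `H(L)` has no antiderivative in any transcendental
dilogarithmic-elementary extension of `F` with constants `ℂ`.  In particular
(`H = 1/Y`), the logarithmic integral `∫ dx/log x` lies in no such extension. -/
theorem stmt13 {F : Type u} [Field F] [CharZero F] (δF : Derivation ℚ F F)
    (c : ℂ →+* F) (x L : F)
    (hc : ∀ a : ℂ, δF (c a) = 0) (hx : δF x = 1) (hL : δF L = x⁻¹)
    (hxtr : Transcendental (↥(Subfield.closure (Set.range ⇑c))) x)
    (hLtr : Transcendental (↥(Subfield.closure (Set.range ⇑c ∪ {x}))) L)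
    (hgen : Subfield.closure (Set.range ⇑c ∪ {x, L}) = ⊤)
    (hconst : ∀ a : F, δF a = 0 → ∃ z : ℂ, a = c z)
    (H : RatFunc ℂ) (hH : ¬ ∃ z : ℂ, H = RatFunc.C z)
    (hnoF : ¬ ∃ w : F, δF w = (Polynomial.eval₂ c L H.num / Polynomial.eval₂ c L H.denom)) :
    (∀ (E : Type v) (_ : Field E) (_ : CharZero E) (δE : Derivation ℚ E E)
        (ι : F →+* E),
        (∀ y : F, δE (ι y) = ι (δF y)) →
        (∀ y : E, δE y = 0 → ∃ z : ℂ, y = ι (c z)) →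
        (∃ (n : ℕ) (θ : Fin n → E), IsTransDilogElemTower δE ι.fieldRange θ) →
        ¬ ∃ u : E, δE u = ι ((Polynomial.eval₂ c L H.num / Polynomial.eval₂ c L H.denom))) ∧
      (∀ (E : Type v) (_ : Field E) (_ : CharZero E) (δE : Derivation ℚ E E)
        (ι : F →+* E),
        (∀ y : F, δE (ι y) = ι (δF y)) →
        (∀ y : E, δE y = 0 → ∃ z : ℂ, y = ι (c z)) →
        (∃ (n : ℕ) (θ : Fin n → E), IsTransDilogElemTower δE ι.fieldRange θ) →
        ¬ ∃ u : E, δE u = ι L⁻¹) := by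
  constructor
  · intro E _ _ δE ι hcomp hcE ⟨n, θ, htow⟩ ⟨u, hu⟩
    exact hnoF (main_aux δF c x L hc hx hL hxtr hLtr hgen _
      (div_mem (eval_mem c L _) (eval_mem c L _)) E δE ι hcomp hcE n θ htow u hu)
  · intro E _ _ δE ι hcomp hcE ⟨n, θ, htow⟩ ⟨u, hu⟩
    obtain ⟨w, hw⟩ := main_aux δF c x L hc hx hL hxtr hLtr hgen _
      (inv_mem (Subfield.subset_closure (Or.inr rfl))) E δE ι hcomp hcE n θ htow u hu
    exact no_inv δF c x L hc hx hL hxtr hLtr hgen hconst w hw
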